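/- arXiv:1705.08466 — 3 statements merged into one kernel-verified Lean document; each statement's English description precedes it below -/
import Mathlib

section
/- If h is a Bloch function on the unit disk, i.e., sup_{z∈D} (1-|z|^2)|h'(z)| < ∞, then for each 0 < p < ∞ there is a constant C (depending on h and p) such that ( (1/2π) ∫_0^{2π} |h(r e^{iθ})|^p dθ )^{1/p} ≤ C (log(1/(1-r)))^{1/2} for all 1/2 ≤ r < 1. -/
open Metric Complex

/-- The `k`-th Taylor coefficient at the origin. -/
noncomputable def taylorCoeff (g : ℂ → ℂ) (k : ℕ) : ℂ :=
  (k.factorial : ℂ)⁻¹ * iteratedDeriv k g 0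

lemma taylorCoeff_deriv (g : ℂ → ℂ) (k : ℕ) :
    taylorCoeff (deriv g) k = (k + 1) * taylorCoeff g (k + 1) := by
  have hk : (k : ℂ) + 1 ≠ 0 := Nat.cast_add_one_ne_zero k
  have hf : (k.factorial : ℂ) ≠ 0 := Nat.cast_ne_zero.2 k.factorial_ne_zero
  simp only [taylorCoeff, iteratedDeriv_succ', Nat.factorial_succ, Nat.cast_mul, Nat.cast_add,
    Nat.cast_one]
  field_simp

lemma hasSum_taylorCoeff {g : ℂ → ℂ} (hg : DifferentiableOn ℂ g (ball 0 1)) {z : ℂ}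
    (hz : z ∈ ball (0 : ℂ) 1) : HasSum (fun k ↦ taylorCoeff g k * z ^ k) (g z) := by
  have hterm : (fun k ↦ taylorCoeff g k * z ^ k) =
      fun k ↦ (k.factorial : ℂ)⁻¹ • (z - 0) ^ k • iteratedDeriv k g 0 := by
    ext k
    simp only [taylorCoeff, smul_eq_mul, sub_zero]
    ring
  rw [hterm]
  exact Complex.hasSum_taylorSeries_on_ball hg hz

lemma continuous_comp_circleMap {E : Type*} [TopologicalSpace E] {f : ℂ → E}
    (hf : ContinuousOn f (ball 0 1)) {r : ℝ}
    (hr0 : 0 ≤ r) (hr1 : r < 1) : Continuous fun θ ↦ f (circleMap 0 r θ) :=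
  hf.comp_continuous (continuous_circleMap 0 r) fun θ ↦ by simpa [abs_of_nonneg hr0] using hr1

lemma circleIntegrable_of_continuousOn_ball {E : Type*} [NormedAddCommGroup E] {f : ℂ → E}
    (hf : ContinuousOn f (ball 0 1)) {r : ℝ}
    (hr0 : 0 ≤ r) (hr1 : r < 1) : CircleIntegrable f 0 r :=
  (continuous_comp_circleMap hf hr0 hr1).intervalIntegrable _ _

lemma circleAverage_inv_pow_mul {g : ℂ → ℂ} (hg : DifferentiableOn ℂ g (ball 0 1)) {r : ℝ}
    (hr0 : 0 < r) (hr1 : r < 1) (k : ℕ) :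
    Real.circleAverage (fun z ↦ (z ^ k)⁻¹ * g z) 0 r = taylorCoeff g k := by
  have hd : DiffContOnCl ℂ g (ball 0 r) := by
    refine DifferentiableOn.diffContOnCl (hg.mono ?_)
    rw [closure_ball _ hr0.ne']
    exact closedBall_subset_ball hr1
  have h := hd.circleIntegral_one_div_sub_center_pow_smul hr0 k
  rw [Real.circleAverage_eq_circleIntegral hr0.ne']
  have : (fun z : ℂ ↦ (z - 0)⁻¹ • ((z ^ k)⁻¹ * g z)) =
      fun z ↦ (1 / (z - 0) ^ (k + 1)) • g z := by
    ext z
    simp only [sub_zero, smul_eq_mul, pow_succ, one_div, mul_inv]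
    ring
  rw [this, h, taylorCoeff, smul_eq_mul, smul_eq_mul]
  have : (2 * Real.pi * I : ℂ) ≠ 0 := two_pi_I_ne_zero
  field_simp

/-- Parseval's identity on the circle of radius `r`. -/
lemma hasSum_normSq_taylorCoeff {g : ℂ → ℂ} (hg : DifferentiableOn ℂ g (ball 0 1)) {r : ℝ}
    (hr0 : 0 < r) (hr1 : r < 1) :
    HasSum (fun k ↦ ‖taylorCoeff g k‖ ^ 2 * r ^ (2 * k))
      (Real.circleAverage (fun z ↦ ‖g z‖ ^ 2) 0 r) := by
  have hmem (θ : ℝ) : circleMap 0 r θ ∈ ball (0 : ℂ) 1 := by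
    simpa [abs_of_pos hr0] using hr1
  have hnorm (θ : ℝ) : ‖circleMap 0 r θ‖ = r := by simp [abs_of_pos hr0]
  have hgc := continuous_comp_circleMap hg.continuousOn hr0.le hr1
  have hcm := continuous_circleMap 0 r
  have hsum : Summable fun k ↦ ‖taylorCoeff g k‖ * r ^ k := by
    simpa [hnorm] using (hasSum_taylorCoeff hg (hmem 0)).summable.norm
  have key : HasSum
      (fun k ↦ ∫ θ in (0 : ℝ)..2 * Real.pi,
        (starRingEnd ℂ) (taylorCoeff g k * circleMap 0 r θ ^ k) * g (circleMap 0 r θ))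
      (∫ θ in (0 : ℝ)..2 * Real.pi, ((‖g (circleMap 0 r θ)‖ ^ 2 : ℝ) : ℂ)) := by
    refine intervalIntegral.hasSum_integral_of_dominated_convergence
      (fun k θ ↦ ‖taylorCoeff g k‖ * r ^ k * ‖g (circleMap 0 r θ)‖) ?_ ?_ ?_ ?_ ?_
    · intro k
      exact ((Complex.continuous_conj.comp (continuous_const.mul (hcm.pow k))).mul
        hgc).aestronglyMeasurable
    · intro k
      refine Filter.Eventually.of_forall fun θ _ ↦ ?_
      rw [norm_mul, RCLike.norm_conj, norm_mul, norm_pow, hnorm]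
    · exact Filter.Eventually.of_forall fun θ _ ↦ hsum.mul_right _
    · simp_rw [tsum_mul_right]
      exact (continuous_const.mul hgc.norm).intervalIntegrable _ _
    · refine Filter.Eventually.of_forall fun θ _ ↦ ?_
      have := ((hasSum_taylorCoeff hg (hmem θ)).map (starRingEnd ℂ)
        Complex.continuous_conj).mul_right (g (circleMap 0 r θ))
      rw [Complex.conj_mul'] at this
      simpa [Function.comp_def] using this
  have hterm (k : ℕ) : ∫ θ in (0 : ℝ)..2 * Real.pi,
        (starRingEnd ℂ) (taylorCoeff g k * circleMap 0 r θ ^ k) * g (circleMap 0 r θ) =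
      ((2 * Real.pi * (‖taylorCoeff g k‖ ^ 2 * r ^ (2 * k)) : ℝ) : ℂ) := by
    have h1 := circleAverage_inv_pow_mul hg hr0 hr1 k
    rw [Real.circleAverage] at h1
    have h2 (θ : ℝ) : (starRingEnd ℂ) (taylorCoeff g k * circleMap 0 r θ ^ k) *
        g (circleMap 0 r θ) = ((starRingEnd ℂ) (taylorCoeff g k) * (r : ℂ) ^ (2 * k)) *
          ((circleMap 0 r θ ^ k)⁻¹ * g (circleMap 0 r θ)) := by
      have hz : circleMap 0 r θ ≠ 0 := circleMap_ne_center hr0.ne'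
      have h3 : (starRingEnd ℂ) (circleMap 0 r θ) = (r : ℂ) ^ 2 * (circleMap 0 r θ)⁻¹ := by
        rw [eq_mul_inv_iff_mul_eq₀ hz, Complex.conj_mul', hnorm]
      rw [map_mul, map_pow, h3, mul_pow, pow_mul, inv_pow]
      ring
    simp_rw [h2]
    rw [intervalIntegral.integral_const_mul]
    have hpi : (2 * Real.pi : ℝ) ≠ 0 := Real.two_pi_pos.ne'
    rw [inv_smul_eq_iff₀ hpi] at h1
    rw [h1]
    have := Complex.conj_mul' (taylorCoeff g k)
    simp only [Complex.real_smul]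
    push_cast
    rw [← this]
    ring
  simp_rw [hterm, intervalIntegral.integral_ofReal] at key
  have := (Complex.hasSum_ofReal.1 key).mul_left (2 * Real.pi)⁻¹
  have hpi : (2 * Real.pi : ℝ) ≠ 0 := Real.two_pi_pos.ne'
  simpa only [inv_mul_cancel_left₀ hpi, Real.circleAverage, smul_eq_mul] using this

lemma integral_sub_mul_pow (r : ℝ) (k : ℕ) :
    ∫ s in (0 : ℝ)..r, (r - s) * s ^ (2 * k) =
      r ^ (2 * (k + 1)) / ((2 * k + 1) * (2 * k + 2)) := by
  have h (s : ℝ) : (r - s) * s ^ (2 * k) = r * s ^ (2 * k) - s ^ (2 * k + 1) := by ring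
  simp_rw [h]
  rw [intervalIntegral.integral_sub ((by fun_prop : Continuous _).intervalIntegrable _ _)
    ((by fun_prop : Continuous _).intervalIntegrable _ _), intervalIntegral.integral_const_mul,
    integral_pow, integral_pow]
  push_cast
  have : (2 * k + 1 : ℝ) ≠ 0 := by positivity
  have : (2 * k + 2 : ℝ) ≠ 0 := by positivity
  have : (2 * k + 1 + 1 : ℝ) ≠ 0 := by positivity
  field_simp
  ring

lemma integral_div_one_sub {r : ℝ} (hr1 : r < 1) (K : ℝ) :
    ∫ s in (0 : ℝ)..r, K / (1 - s) = K * Real.log (1 / (1 - r)) := by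
  simp_rw [div_eq_mul_inv]
  rw [intervalIntegral.integral_const_mul,
    intervalIntegral.integral_comp_sub_left (fun x ↦ x⁻¹) 1, sub_zero,
    integral_inv_of_pos (by linarith) one_pos, one_div, one_mul]

lemma circleAverage_normSq_le_of_deriv {g : ℂ → ℂ} (hg : DifferentiableOn ℂ g (ball 0 1))
    {r K : ℝ} (hr0 : 0 < r) (hr1 : r < 1)
    (hK : ∀ s, 0 < s → s < r →
      Real.circleAverage (fun z ↦ ‖deriv g z‖ ^ 2) 0 s ≤ K / (1 - s) ^ 2) :
    Real.circleAverage (fun z ↦ ‖g z‖ ^ 2) 0 r ≤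
      ‖g 0‖ ^ 2 + 4 * K * Real.log (1 / (1 - r)) := by
  have hK0 : 0 ≤ K := by
    have h1 := hK (r / 2) (by linarith) (by linarith)
    have h2 : 0 ≤ Real.circleAverage (fun z ↦ ‖deriv g z‖ ^ 2) 0 (r / 2) :=
      Real.circleAverage_nonneg_of_nonneg fun z _ ↦ by positivity
    have h3 : 0 < (1 - r / 2) ^ 2 := pow_pos (by linarith) 2
    by_contra! hneg
    exact absurd (h2.trans h1) (not_le.2 (div_neg_of_neg_of_pos hneg h3))
  have hlog : 0 ≤ Real.log (1 / (1 - r)) :=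
    Real.log_nonneg ((one_le_div (by linarith)).2 (by linarith))
  have hdg : DifferentiableOn ℂ (deriv g) (ball 0 1) := hg.deriv isOpen_ball
  refine le_of_tendsto ((hasSum_normSq_taylorCoeff hg hr0 hr1).tendsto_sum_nat.comp
    (Filter.tendsto_add_atTop_nat 1)) (Filter.Eventually.of_forall fun N ↦ ?_)
  simp only [Function.comp_apply]
  rw [Finset.sum_range_succ', add_comm]
  refine add_le_add (by simp [taylorCoeff]) ?_
  calc ∑ k ∈ Finset.range N, ‖taylorCoeff g (k + 1)‖ ^ 2 * r ^ (2 * (k + 1))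
      ≤ ∑ k ∈ Finset.range N, 4 * (‖taylorCoeff (deriv g) k‖ ^ 2 *
          ∫ s in (0 : ℝ)..r, (r - s) * s ^ (2 * k)) := by
        refine Finset.sum_le_sum fun k _ ↦ ?_
        have hn : ‖(k : ℂ) + 1‖ = k + 1 := by
          exact_mod_cast Complex.norm_natCast (k + 1)
        rw [integral_sub_mul_pow, taylorCoeff_deriv, norm_mul, hn, mul_pow]
        have h4 : (1 : ℝ) ≤ 4 * (k + 1) ^ 2 / ((2 * k + 1) * (2 * k + 2)) := by
          rw [one_le_div (by positivity)]
          nlinarith [(Nat.cast_nonneg k : (0 : ℝ) ≤ k)]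
        calc _ ≤ ‖taylorCoeff g (k + 1)‖ ^ 2 * r ^ (2 * (k + 1)) *
              (4 * (k + 1) ^ 2 / ((2 * k + 1) * (2 * k + 2))) :=
              le_mul_of_one_le_right (by positivity) h4
          _ = _ := by ring
    _ = 4 * ∫ s in (0 : ℝ)..r, ∑ k ∈ Finset.range N,
          ‖taylorCoeff (deriv g) k‖ ^ 2 * ((r - s) * s ^ (2 * k)) := by
        rw [intervalIntegral.integral_finsetSum fun k _ ↦
          (by fun_prop : Continuous _).intervalIntegrable _ _]
        simp_rw [intervalIntegral.integral_const_mul, Finset.mul_sum]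
    _ ≤ 4 * ∫ s in (0 : ℝ)..r, K / (1 - s) := by
        refine mul_le_mul_of_nonneg_left ?_ (by norm_num)
        refine intervalIntegral.integral_mono_on_of_le_Ioo hr0.le
          ((by fun_prop : Continuous _).intervalIntegrable _ _) ?_ fun s hs ↦ ?_
        · refine ContinuousOn.intervalIntegrable (ContinuousOn.div (by fun_prop) (by fun_prop) ?_)
          intro s hs
          rw [Set.uIcc_of_le hr0.le] at hs
          linarith [hs.2]
        · have hs1 : 0 < 1 - s := by linarith [hs.2]
          have h5 : ∑ k ∈ Finset.range N, ‖taylorCoeff (deriv g) k‖ ^ 2 * s ^ (2 * k) ≤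
              K / (1 - s) ^ 2 :=
            (sum_le_hasSum _ (fun k _ ↦ mul_nonneg (by positivity) (pow_nonneg hs.1.le _))
              (hasSum_normSq_taylorCoeff hdg hs.1 (hs.2.trans hr1))).trans (hK s hs.1 hs.2)
          calc _ = (r - s) * ∑ k ∈ Finset.range N,
                ‖taylorCoeff (deriv g) k‖ ^ 2 * s ^ (2 * k) := by
                rw [Finset.mul_sum]
                exact Finset.sum_congr rfl fun k _ ↦ by ring
            _ ≤ (1 - s) * (K / (1 - s) ^ 2) :=
                mul_le_mul (by linarith) h5 (Finset.sum_nonneg fun k _ ↦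
                  mul_nonneg (by positivity) (pow_nonneg hs.1.le _)) hs1.le
            _ = K / (1 - s) := by field_simp
    _ = 4 * K * Real.log (1 / (1 - r)) := by
        rw [integral_div_one_sub hr1, mul_assoc]

/-- Even integral means of a Bloch function. -/
lemma bloch_even_integral_mean_le {h : ℂ → ℂ} (hd : DifferentiableOn ℂ h (ball 0 1)) {M : ℝ}
    (hB : ∀ z ∈ ball (0 : ℂ) 1, (1 - ‖z‖ ^ 2) * ‖deriv h z‖ ≤ M) (n : ℕ) :
    ∃ C : ℝ, 0 ≤ C ∧ ∀ r : ℝ, 0 < r → r < 1 →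
      Real.circleAverage (fun z ↦ ‖h z ^ n‖ ^ 2) 0 r ≤
        C * (1 + Real.log (1 / (1 - r))) ^ n := by
  induction n with
  | zero =>
    refine ⟨1, zero_le_one, fun r _ _ ↦ ?_⟩
    simp [Real.circleAverage_const]
  | succ n ih =>
    obtain ⟨C, hC, hCr⟩ := ih
    have hM : 0 ≤ M := (norm_nonneg (deriv h 0)).trans (by simpa using hB 0 (by simp))
    refine ⟨‖h 0 ^ (n + 1)‖ ^ 2 + 4 * ((n + 1) ^ 2 * M ^ 2 * C), by positivity,
      fun r hr0 hr1 ↦ ?_⟩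
    have hlog : 0 ≤ Real.log (1 / (1 - r)) :=
      Real.log_nonneg ((one_le_div (by linarith)).2 (by linarith))
    set L := Real.log (1 / (1 - r)) with hL
    have hdn : DifferentiableOn ℂ (fun z ↦ h z ^ (n + 1)) (ball 0 1) := hd.pow (n + 1)
    have hmain := circleAverage_normSq_le_of_deriv hdn (r := r)
      (K := (n + 1) ^ 2 * M ^ 2 * (C * (1 + L) ^ n)) hr0 hr1 fun s hs0 hsr ↦ ?_
    · refine hmain.trans ?_
      have h1 : (1 : ℝ) ≤ (1 + L) ^ (n + 1) := one_le_pow₀ (by linarith)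
      calc _ ≤ ‖h 0 ^ (n + 1)‖ ^ 2 * (1 + L) ^ (n + 1) +
            4 * ((n + 1) ^ 2 * M ^ 2 * (C * (1 + L) ^ n)) * (1 + L) := by
            gcongr
            · exact le_mul_of_one_le_right (by positivity) h1
            · linarith
        _ = _ := by ring
    · have hs1 : s < 1 := hsr.trans hr1
      have hsp : 0 < 1 - s := by linarith
      have hlogs : Real.log (1 / (1 - s)) ≤ L :=
        Real.log_le_log (by positivity) (one_div_le_one_div_of_le (by linarith) (by linarith))
      have hlogs0 : 0 ≤ Real.log (1 / (1 - s)) :=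
        Real.log_nonneg ((one_le_div (by linarith)).2 (by linarith))
      calc _ ≤ Real.circleAverage
            (fun z ↦ ((n + 1) ^ 2 * M ^ 2 / (1 - s) ^ 2) • ‖h z ^ n‖ ^ 2) 0 s := by
            refine Real.circleAverage_mono
              (circleIntegrable_of_continuousOn_ball
                ((hdn.deriv isOpen_ball).continuousOn.norm.pow 2) hs0.le hs1)
              (circleIntegrable_of_continuousOn_ball
                (((hd.continuousOn.pow n).norm.pow 2).const_smul
                  ((n + 1) ^ 2 * M ^ 2 / (1 - s) ^ 2))
                hs0.le hs1) fun z hz ↦ ?_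
            have hzs : ‖z‖ = s := by simpa [abs_of_pos hs0] using hz
            have hzb : z ∈ ball (0 : ℂ) 1 := by simpa [hzs] using hs1
            have hdz : DifferentiableAt ℂ h z := hd.differentiableAt (isOpen_ball.mem_nhds hzb)
            have hder : deriv (fun z ↦ h z ^ (n + 1)) z = (n + 1) * h z ^ n * deriv h z := by
              simpa using (hdz.hasDerivAt.fun_pow (n + 1)).deriv
            have hn : ‖(n : ℂ) + 1‖ = n + 1 := by
              exact_mod_cast Complex.norm_natCast (n + 1)
            have hbd : ‖deriv h z‖ ≤ M / (1 - s) := by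
              rw [le_div_iff₀ hsp]
              have := hB z hzb
              rw [hzs] at this
              nlinarith [mul_nonneg (mul_nonneg hs0.le hsp.le) (norm_nonneg (deriv h z))]
            rw [hder, norm_mul, norm_mul, hn, smul_eq_mul]
            calc _ ≤ ((n + 1) * ‖h z ^ n‖ * (M / (1 - s))) ^ 2 := by gcongr
              _ = _ := by
                rw [mul_pow, div_pow]
                ring
        _ = (n + 1) ^ 2 * M ^ 2 / (1 - s) ^ 2 *
            Real.circleAverage (fun z ↦ ‖h z ^ n‖ ^ 2) 0 s := by
            rw [Real.circleAverage_fun_smul, smul_eq_mul]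
        _ ≤ (n + 1) ^ 2 * M ^ 2 / (1 - s) ^ 2 * (C * (1 + L) ^ n) := by
            have h6 : C * (1 + Real.log (1 / (1 - s))) ^ n ≤ C * (1 + L) ^ n := by gcongr
            have := (hCr s hs0 hs1).trans h6
            gcongr
        _ = _ := by ring

lemma rpow_le_one_add_rpow {x p q : ℝ} (hx : 0 ≤ x) (hp : 0 < p) (hpq : p ≤ q) :
    x ^ p ≤ 1 + x ^ q := by
  rcases le_total x 1 with h | h
  · linarith [Real.rpow_le_one hx h hp.le, Real.rpow_nonneg hx q]
  · linarith [Real.rpow_le_rpow_of_exponent_le h hpq]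

/-- A Bloch function `h` satisfies
`((1/2π) ∫₀^{2π} |h(r e^{iθ})|^p dθ)^{1/p} ≤ C (log(1/(1-r)))^{1/2}` for `1/2 ≤ r < 1`. -/
theorem bloch_integral_mean_growth (h : ℂ → ℂ)
    (hd : DifferentiableOn ℂ h (ball (0 : ℂ) 1))
    (hB : ∃ M : ℝ, ∀ z ∈ ball (0 : ℂ) 1, (1 - ‖z‖ ^ 2) * ‖deriv h z‖ ≤ M)
    (p : ℝ) (hp : 0 < p) :
    ∃ C : ℝ, ∀ r : ℝ, 1 / 2 ≤ r → r < 1 →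
      ((2 * Real.pi)⁻¹ * ∫ θ in (0 : ℝ)..(2 * Real.pi),
          ‖h (r * Complex.exp (θ * Complex.I))‖ ^ p) ^ (1 / p)
        ≤ C * (Real.log (1 / (1 - r))) ^ ((1 : ℝ) / 2) := by
  obtain ⟨M, hM⟩ := hB
  obtain ⟨n, hn⟩ := exists_nat_ge p
  obtain ⟨C, hC, hCr⟩ := bloch_even_integral_mean_le hd hM n
  refine ⟨(1 + C * 3 ^ n) ^ (1 / p), fun r hr hr1 ↦ ?_⟩
  have hr0 : 0 < r := by linarith
  have hlog : 1 / 2 ≤ Real.log (1 / (1 - r)) := by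
    refine le_trans ?_ (Real.log_le_log two_pos ((le_div_iff₀ (by linarith)).2 (by linarith)))
    linarith [Real.log_two_gt_d9]
  have hCL := hCr r hr0 hr1
  set L := Real.log (1 / (1 - r)) with hL
  have hL0 : 0 < L := by linarith
  set l := L ^ ((1 : ℝ) / 2) with hl
  have hl0 : 0 < l := Real.rpow_pos_of_pos hL0 _
  have hl2 : l ^ 2 = L := by
    rw [hl, ← Real.rpow_natCast, ← Real.rpow_mul hL0.le]
    norm_num
  have hpt (z : ℂ) : ‖h z‖ ^ p ≤ l ^ p + (l ^ p / L ^ n) • ‖h z ^ n‖ ^ 2 := by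
    have h1 := rpow_le_one_add_rpow (x := ‖h z‖ / l) (q := (2 * n : ℕ)) (by positivity) hp
      (by push_cast; linarith)
    rw [Real.rpow_natCast, div_pow, Real.div_rpow (norm_nonneg _) hl0.le,
      div_le_iff₀ (by positivity), pow_mul l, hl2] at h1
    refine h1.trans_eq ?_
    rw [norm_pow, smul_eq_mul]
    ring
  have hint1 : CircleIntegrable (fun z ↦ ‖h z‖ ^ p) 0 r :=
    circleIntegrable_of_continuousOn_ball
      (hd.continuousOn.norm.rpow_const fun _ _ ↦ Or.inr hp.le) hr0.le hr1
  have hint2 : CircleIntegrable (fun z ↦ (l ^ p / L ^ n) • ‖h z ^ n‖ ^ 2) 0 r :=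
    circleIntegrable_of_continuousOn_ball
      (((hd.continuousOn.pow n).norm.pow 2).const_smul (l ^ p / L ^ n)) hr0.le hr1
  have hconst : CircleIntegrable (fun _ : ℂ ↦ l ^ p) 0 r :=
    circleIntegrable_of_continuousOn_ball continuousOn_const hr0.le hr1
  have hmean : (2 * Real.pi)⁻¹ * ∫ θ in (0 : ℝ)..(2 * Real.pi),
      ‖h (r * Complex.exp (θ * Complex.I))‖ ^ p = Real.circleAverage (fun z ↦ ‖h z‖ ^ p) 0 r := by
    simp [Real.circleAverage, circleMap]
  have hbound : Real.circleAverage (fun z ↦ ‖h z‖ ^ p) 0 r ≤ (1 + C * 3 ^ n) * l ^ p := by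
    calc _ ≤ Real.circleAverage (fun z ↦ l ^ p + (l ^ p / L ^ n) • ‖h z ^ n‖ ^ 2) 0 r :=
          Real.circleAverage_mono hint1 (hconst.add hint2) fun z _ ↦ hpt z
      _ = l ^ p + l ^ p / L ^ n * Real.circleAverage (fun z ↦ ‖h z ^ n‖ ^ 2) 0 r := by
          rw [Real.circleAverage_fun_add hconst hint2, Real.circleAverage_const,
            Real.circleAverage_fun_smul, smul_eq_mul]
      _ ≤ l ^ p + l ^ p / L ^ n * (C * (3 * L) ^ n) := by
          have h7 : C * (1 + L) ^ n ≤ C * (3 * L) ^ n := by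
            gcongr
            linarith
          have := hCL.trans h7
          gcongr
      _ = _ := by
          rw [mul_pow]
          field_simp
  rw [hmean]
  refine (Real.rpow_le_rpow (Real.circleAverage_nonneg_of_nonneg fun z _ ↦ by positivity) hbound
    (by positivity)).trans_eq ?_
  rw [Real.mul_rpow (by positivity) (by positivity), ← Real.rpow_mul hl0.le,
    mul_one_div_cancel hp.ne', Real.rpow_one]
end

section
/- If g1, g2 are analytic on the unit disk and |g1(w)| + |g2(w)| ≥ (1/12) log(e/(1-|w|)) for all w with 1 - e^{-3} < |w| < 1, then for at least one j ∈ {1,2}, limsup_{r→1^-} [ (1/2π) ∫_0^{2π} |g_j(r e^{iθ})| dθ ] / (log(1/(1-r)))^{1/2} = ∞. In particular, at least one of g1, g2 is not a Bloch function. -/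
open Metric Filter

open scoped Topology ComplexConjugate

/-- Differentiation under an interval integral when the integrand and its derivative are jointly
continuous. -/
lemma hasDerivAt_intervalIntegral_of_continuousOn {F F' : ℝ → ℝ → ℂ} {U : Set ℝ} (hU : IsOpen U)
    (hF : ContinuousOn (Function.uncurry F) (U ×ˢ Set.univ))
    (hF' : ContinuousOn (Function.uncurry F') (U ×ˢ Set.univ))
    (hd : ∀ u ∈ U, ∀ t, HasDerivAt (fun x => F x t) (F' u t) u)
    (a b : ℝ) {u : ℝ} (hu : u ∈ U) :
    HasDerivAt (fun x => ∫ t in a..b, F x t) (∫ t in a..b, F' u t) u := by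
  have slice : ∀ {G : ℝ → ℝ → ℂ}, ContinuousOn (Function.uncurry G) (U ×ˢ Set.univ) →
      ∀ x ∈ U, Continuous (G x) := fun {G} hG x hx =>
    hG.comp_continuous (f := fun t : ℝ => (x, t)) (by fun_prop) (fun t => ⟨hx, Set.mem_univ t⟩)
  obtain ⟨ε, hε, hball⟩ := nhds_basis_closedBall.mem_iff.1 (hU.mem_nhds hu)
  have hcomp : IsCompact (closedBall u ε ×ˢ Set.uIcc a b) :=
    (isCompact_closedBall u ε).prod isCompact_uIcc
  obtain ⟨C, hC⟩ := hcomp.exists_bound_of_continuousOn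
    (hF'.mono (Set.prod_mono hball (Set.subset_univ _)))
  refine (intervalIntegral.hasDerivAt_integral_of_dominated_loc_of_deriv_le
    (F := F) (F' := F') (bound := fun _ => C)
    (closedBall_mem_nhds u hε) ?_ ?_ ?_ ?_ ?_ ?_).2
  · filter_upwards [hU.mem_nhds hu] with x hx
    exact (slice hF x hx).aestronglyMeasurable
  · exact (slice hF u hu).intervalIntegrable _ _
  · exact (slice hF' u hu).aestronglyMeasurable
  · exact Eventually.of_forall fun t ht x hx =>
      hC (x, t) ⟨hx, Set.uIoc_subset_uIcc ht⟩
  · exact intervalIntegrable_const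
  · exact Eventually.of_forall fun t _ x hx => hd x (hball hx) t

/-- The sesquilinear pairing of two functions over a vertical segment of length `2π`. -/
noncomputable def verticalPairing (P Q : ℂ → ℂ) (u : ℝ) : ℂ :=
  ∫ t in (0 : ℝ)..(2 * Real.pi), conj (P (u + t * Complex.I)) * Q (u + t * Complex.I)

lemma isOpen_re_neg : IsOpen {w : ℂ | w.re < 0} :=
  isOpen_lt Complex.continuous_re continuous_const

lemma re_add_mul_I_neg {u : ℝ} (hu : u < 0) (t : ℝ) :
    (u : ℂ) + t * Complex.I ∈ {w : ℂ | w.re < 0} := by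
  simpa using hu

lemma continuousOn_vertical {P : ℂ → ℂ} (hP : ContinuousOn P {w | w.re < 0}) :
    ContinuousOn (fun p : ℝ × ℝ => P (p.1 + p.2 * Complex.I)) (Set.Iio 0 ×ˢ Set.univ) :=
  hP.comp (by fun_prop) fun p hp => re_add_mul_I_neg hp.1 p.2

lemma continuous_vertical {P : ℂ → ℂ} (hP : ContinuousOn P {w | w.re < 0}) {u : ℝ} (hu : u < 0) :
    Continuous fun t : ℝ => P (u + t * Complex.I) :=
  hP.comp_continuous (by fun_prop) (re_add_mul_I_neg hu)

lemma hasDerivAt_horizontal {P : ℂ → ℂ} (hP : DifferentiableOn ℂ P {w | w.re < 0}) {u : ℝ}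
    (hu : u < 0) (t : ℝ) :
    HasDerivAt (fun x : ℝ => P (x + t * Complex.I)) (deriv P (u + t * Complex.I)) u := by
  have h := (hP.differentiableAt (isOpen_re_neg.mem_nhds (re_add_mul_I_neg hu t))).hasDerivAt
  have h2 : HasDerivAt (fun x : ℝ => (x : ℂ) + t * Complex.I) 1 u :=
    (Complex.ofRealCLM.hasDerivAt (x := u)).add_const _
  exact (h.comp u h2).congr_deriv (mul_one _)

lemma hasDerivAt_vertical {P : ℂ → ℂ} (hP : DifferentiableOn ℂ P {w | w.re < 0}) {u : ℝ}
    (hu : u < 0) (t : ℝ) :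
    HasDerivAt (fun x : ℝ => P (u + x * Complex.I)) (deriv P (u + t * Complex.I) * Complex.I)
      t := by
  have h := (hP.differentiableAt (isOpen_re_neg.mem_nhds (re_add_mul_I_neg hu t))).hasDerivAt
  have h2 : HasDerivAt (fun x : ℝ => (u : ℂ) + x * Complex.I) (1 * Complex.I) t :=
    ((Complex.ofRealCLM.hasDerivAt (x := t)).mul_const _).const_add _
  exact (h.comp t h2).congr_deriv (by rw [one_mul])

/-- For holomorphic functions, integration by parts moves derivatives across the pairing. -/
lemma verticalPairing_deriv_comm {P Q : ℂ → ℂ} (hP : DifferentiableOn ℂ P {w | w.re < 0})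
    (hQ : DifferentiableOn ℂ Q {w | w.re < 0})
    (hPper : ∀ w, P (w + 2 * Real.pi * Complex.I) = P w)
    (hQper : ∀ w, Q (w + 2 * Real.pi * Complex.I) = Q w) {u : ℝ} (hu : u < 0) :
    verticalPairing (deriv P) Q u = verticalPairing P (deriv Q) u := by
  have cP := continuous_vertical hP.continuousOn hu
  have cQ := continuous_vertical hQ.continuousOn hu
  have cP' := continuous_vertical (hP.deriv isOpen_re_neg).continuousOn hu
  have cQ' := continuous_vertical (hQ.deriv isOpen_re_neg).continuousOn hu
  have c1 : Continuous fun t : ℝ =>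
      conj (deriv P (u + t * Complex.I)) * Q (u + t * Complex.I) :=
    (Complex.continuous_conj.comp cP').mul cQ
  have c2 : Continuous fun t : ℝ =>
      conj (P (u + t * Complex.I)) * deriv Q (u + t * Complex.I) :=
    (Complex.continuous_conj.comp cP).mul cQ'
  have key := intervalIntegral.integral_eq_sub_of_hasDerivAt (a := 0) (b := 2 * Real.pi)
    (f := fun t : ℝ => conj (P (u + t * Complex.I)) * Q (u + t * Complex.I))
    (f' := fun t : ℝ => Complex.I * (conj (P (u + t * Complex.I)) * deriv Q (u + t * Complex.I)
      - conj (deriv P (u + t * Complex.I)) * Q (u + t * Complex.I)))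
    (fun t _ => by
      have h := (hasDerivAt_vertical hP hu t).star.mul (hasDerivAt_vertical hQ hu t)
      refine h.congr_deriv ?_
      simp
      ring)
    ((continuous_const.mul (c2.sub c1)).intervalIntegrable _ _)
  have e1 : P (u + (2 * Real.pi : ℝ) * Complex.I) = P u := by
    rw [← hPper u]; push_cast; rfl
  have e2 : Q (u + (2 * Real.pi : ℝ) * Complex.I) = Q u := by
    rw [← hQper u]; push_cast; rfl
  rw [intervalIntegral.integral_const_mul, intervalIntegral.integral_sub
    (c2.intervalIntegrable _ _) (c1.intervalIntegrable _ _), e1, e2] at key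
  simp only [Complex.ofReal_zero, zero_mul, add_zero, sub_self, mul_eq_zero, Complex.I_ne_zero,
    false_or] at key
  exact (sub_eq_zero.1 key).symm

lemma hasDerivAt_verticalPairing {P Q : ℂ → ℂ} (hP : DifferentiableOn ℂ P {w | w.re < 0})
    (hQ : DifferentiableOn ℂ Q {w | w.re < 0}) {u : ℝ} (hu : u < 0) :
    HasDerivAt (verticalPairing P Q)
      (verticalPairing (deriv P) Q u + verticalPairing P (deriv Q) u) u := by
  have hP' := hP.deriv isOpen_re_neg
  have hQ' := hQ.deriv isOpen_re_neg
  have conjc : ∀ {R : ℂ → ℂ}, DifferentiableOn ℂ R {w | w.re < 0} →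
      ContinuousOn (fun p : ℝ × ℝ => conj (R (p.1 + p.2 * Complex.I))) (Set.Iio 0 ×ˢ Set.univ) :=
    fun {R} hR => Complex.continuous_conj.comp_continuousOn (continuousOn_vertical hR.continuousOn)
  have conjv : ∀ {R : ℂ → ℂ}, DifferentiableOn ℂ R {w | w.re < 0} →
      Continuous (fun t : ℝ => conj (R (u + t * Complex.I))) :=
    fun {R} hR => Complex.continuous_conj.comp (continuous_vertical hR.continuousOn hu)
  have h := hasDerivAt_intervalIntegral_of_continuousOn (U := Set.Iio 0) isOpen_Iio
    (F := fun x t : ℝ => conj (P (x + t * Complex.I)) * Q (x + t * Complex.I))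
    (F' := fun x t : ℝ => conj (deriv P (x + t * Complex.I)) * Q (x + t * Complex.I)
      + conj (P (x + t * Complex.I)) * deriv Q (x + t * Complex.I))
    ((conjc hP).mul (continuousOn_vertical hQ.continuousOn))
    (((conjc hP').mul (continuousOn_vertical hQ.continuousOn)).add
      ((conjc hP).mul (continuousOn_vertical hQ'.continuousOn)))
    (fun x hx t => (hasDerivAt_horizontal hP hx t).star.mul (hasDerivAt_horizontal hQ hx t))
    0 (2 * Real.pi) hu
  exact h.congr_deriv (intervalIntegral.integral_add
    (((conjv hP').mul (continuous_vertical hQ.continuousOn hu)).intervalIntegrable _ _)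
    (((conjv hP).mul (continuous_vertical hQ'.continuousOn hu)).intervalIntegrable _ _))

lemma antitoneOn_Ico_neg_one {f f' : ℝ → ℝ} (hf : ∀ u < 0, HasDerivAt f (f' u) u)
    (hf' : ∀ u, -1 ≤ u → u < 0 → f' u ≤ 0) : AntitoneOn f (Set.Ico (-1) 0) := by
  refine antitoneOn_of_deriv_nonpos (convex_Ico _ _)
    (fun u hu => (hf u hu.2).continuousAt.continuousWithinAt) ?_ ?_ <;>
  rw [interior_Ico] <;> intro u hu
  · exact (hf u hu.2).differentiableAt.differentiableWithinAt
  · rw [(hf u hu.2).deriv]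
    exact hf' u hu.1.le hu.2

/-- A function whose second derivative is `O(u⁻²)` grows at most logarithmically at `0`. -/
lemma exists_log_bound_of_second_deriv_le {a b d : ℝ → ℝ} {K : ℝ}
    (ha : ∀ u < 0, HasDerivAt a (2 * b u) u) (hb : ∀ u < 0, HasDerivAt b (2 * d u) u)
    (hd : ∀ u < 0, 2 * d u ≤ K / u ^ 2) :
    ∃ C, ∀ u, -1 ≤ u → u < 0 → a u ≤ C + 2 * K * -Real.log (-u) := by
  have m1 : (-1 : ℝ) ∈ Set.Ico (-1 : ℝ) 0 := by norm_num
  have h1 : AntitoneOn (fun u => b u + K * u⁻¹) (Set.Ico (-1) 0) := by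
    refine antitoneOn_Ico_neg_one
      (fun u hu => (hb u hu).add ((hasDerivAt_inv hu.ne).const_mul K)) fun u _ hu => ?_
    have := hd u hu
    rw [div_eq_mul_inv] at this
    linarith
  have h1' : ∀ u, -1 ≤ u → u < 0 → b u ≤ b (-1) - K - K * u⁻¹ := fun u hu hu0 => by
    have := h1 m1 ⟨hu, hu0⟩ hu
    norm_num at this
    linarith
  set c := b (-1) - K with hc
  have h2 : AntitoneOn (fun u => a u - 2 * c * u + 2 * K * Real.log (-u)) (Set.Ico (-1) 0) := by
    refine antitoneOn_Ico_neg_one (fun u hu => ((ha u hu).sub ((hasDerivAt_id u).const_mul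
      (2 * c))).add (((hasDerivAt_id u).neg.log (by simpa using hu.ne)).const_mul (2 * K)))
      fun u hu hu0 => ?_
    have := h1' u hu hu0
    have e : (-1 : ℝ) / (-id) u = u⁻¹ := by
      simp [neg_div_neg_eq]
    rw [e]
    linarith
  refine ⟨a (-1) + 2 * c + 2 * |c|, fun u hu hu0 => ?_⟩
  have h3 := h2 m1 ⟨hu, hu0⟩ hu
  simp only [neg_neg, Real.log_one] at h3
  have h4 : c * u ≤ |c| := by
    calc c * u ≤ |c * u| := le_abs_self _
      _ = |c| * |u| := abs_mul _ _
      _ ≤ |c| * 1 := by gcongr; rw [abs_le]; constructor <;> linarith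
      _ = |c| := mul_one _
  linarith

lemma exp_mul_neg_le {u : ℝ} (h : u < 0) : Real.exp u * (-u) ≤ 1 - Real.exp u ^ 2 := by
  have h1 := Real.add_one_le_exp (-u)
  have h2 : Real.exp u ≤ 1 := Real.exp_le_one_iff.2 h.le
  have h3 : Real.exp u * Real.exp (-u) = 1 := by rw [← Real.exp_add]; simp
  nlinarith [Real.exp_pos u]

lemma norm_exp_mem_ball {w : ℂ} (hw : w.re < 0) : Complex.exp w ∈ ball (0 : ℂ) 1 := by
  rw [mem_ball_zero_iff, Complex.norm_exp]
  exact Real.exp_lt_one_iff.2 hw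

/-- The quadratic integral means of a Bloch function grow at most logarithmically. -/
lemma exists_sq_integral_le_of_bloch {g : ℂ → ℂ} (hg : DifferentiableOn ℂ g (ball (0 : ℂ) 1))
    {M : ℝ} (hM : ∀ z ∈ ball (0 : ℂ) 1, (1 - ‖z‖ ^ 2) * ‖deriv g z‖ ≤ M) :
    ∃ C K : ℝ, 0 ≤ C ∧ 0 ≤ K ∧ ∀ r : ℝ, Real.exp (-1) ≤ r → r < 1 →
      (∫ θ in (0 : ℝ)..(2 * Real.pi), ‖g (r * Complex.exp (θ * Complex.I))‖ ^ 2)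
        ≤ C + K * Real.log (1 / (1 - r)) := by
  set G : ℂ → ℂ := fun w => g (Complex.exp w) with hGdef
  have hG : DifferentiableOn ℂ G {w | w.re < 0} :=
    hg.comp Complex.differentiable_exp.differentiableOn fun w hw => norm_exp_mem_ball hw
  have hG' := hG.deriv isOpen_re_neg
  have hper : ∀ w, G (w + 2 * Real.pi * Complex.I) = G w := fun w => by
    simp only [hGdef, Complex.exp_periodic w]
  have hper' : ∀ w, deriv G (w + 2 * Real.pi * Complex.I) = deriv G w := fun w => by
    rw [← deriv_comp_add_const]
    congr 1
    exact funext hper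
  have hbound : ∀ u : ℝ, u < 0 → ∀ t : ℝ, ‖deriv G (u + t * Complex.I)‖ ≤ M / (-u) := by
    intro u hu t
    have hz := norm_exp_mem_ball (re_add_mul_I_neg hu t)
    have hd : deriv G (u + t * Complex.I) =
        deriv g (Complex.exp (u + t * Complex.I)) * Complex.exp (u + t * Complex.I) :=
      ((hg.differentiableAt (isOpen_ball.mem_nhds hz)).hasDerivAt.comp _
        (Complex.hasDerivAt_exp _)).deriv
    have h1 := hM _ hz
    have h2 := exp_mul_neg_le hu
    have hn : ‖Complex.exp (u + t * Complex.I)‖ = Real.exp u := by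
      rw [Complex.norm_exp]; simp
    rw [hn] at h1
    rw [hd, norm_mul, hn, le_div_iff₀ (by linarith)]
    nlinarith [norm_nonneg (deriv g (Complex.exp (u + t * Complex.I)))]
  have ha : ∀ u < 0, HasDerivAt (fun x => (verticalPairing G G x).re)
      (2 * (verticalPairing G (deriv G) u).re) u := fun u hu => by
    have h := hasDerivAt_verticalPairing hG hG hu
    rw [verticalPairing_deriv_comm hG hG hper hper hu] at h
    refine (Complex.reCLM.hasFDerivAt.comp_hasDerivAt u h).congr_deriv ?_
    simp [two_mul]
  have hb : ∀ u < 0, HasDerivAt (fun x => (verticalPairing G (deriv G) x).re)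
      (2 * (verticalPairing (deriv G) (deriv G) u).re) u := fun u hu => by
    have h := hasDerivAt_verticalPairing hG hG' hu
    rw [← verticalPairing_deriv_comm hG hG' hper hper' hu] at h
    refine (Complex.reCLM.hasFDerivAt.comp_hasDerivAt u h).congr_deriv ?_
    simp [two_mul]
  have hd : ∀ u < 0, 2 * (verticalPairing (deriv G) (deriv G) u).re
      ≤ (4 * Real.pi * M ^ 2) / u ^ 2 := fun u hu => by
    have h1 : ‖verticalPairing (deriv G) (deriv G) u‖
        ≤ (M / (-u)) ^ 2 * |2 * Real.pi - 0| := by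
      refine intervalIntegral.norm_integral_le_of_norm_le_const fun t _ => ?_
      rw [norm_mul, Complex.norm_conj, ← sq]
      gcongr
      exact hbound u hu t
    rw [sub_zero, abs_of_pos Real.two_pi_pos, div_pow, neg_sq] at h1
    have h2 := (Complex.re_le_norm _).trans h1
    calc _ ≤ 2 * (M ^ 2 / u ^ 2 * (2 * Real.pi)) := by linarith
      _ = _ := by ring
  obtain ⟨C, hC⟩ := exists_log_bound_of_second_deriv_le ha hb hd
  refine ⟨|C|, 2 * (4 * Real.pi * M ^ 2), abs_nonneg _, by positivity, fun r hr hr1 => ?_⟩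
  have hr0 : 0 < r := (Real.exp_pos _).trans_le hr
  have h1 := hC (Real.log r) ((Real.le_log_iff_exp_le hr0).2 hr) (Real.log_neg hr0 hr1)
  have h2 : -Real.log (-Real.log r) ≤ Real.log (1 / (1 - r)) := by
    rw [one_div, Real.log_inv]
    have := Real.log_le_sub_one_of_pos hr0
    exact neg_le_neg (Real.log_le_log (by linarith) (by linarith))
  have h3 : (verticalPairing G G (Real.log r)).re
      = ∫ θ in (0 : ℝ)..(2 * Real.pi), ‖g (r * Complex.exp (θ * Complex.I))‖ ^ 2 := by
    have e : verticalPairing G G (Real.log r) = ∫ θ in (0 : ℝ)..(2 * Real.pi),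
        ((‖g (r * Complex.exp (θ * Complex.I))‖ ^ 2 : ℝ) : ℂ) := by
      refine intervalIntegral.integral_congr fun t _ => ?_
      have e1 : Complex.exp (Real.log r + t * Complex.I) = r * Complex.exp (t * Complex.I) := by
        rw [Complex.exp_add, ← Complex.ofReal_exp, Real.exp_log hr0]
      simp only [hGdef, e1, Complex.conj_mul']
      push_cast
      rfl
    rw [e, intervalIntegral.integral_ofReal, Complex.ofReal_re]
  rw [← h3]
  calc _ ≤ C + 2 * (4 * Real.pi * M ^ 2) * -Real.log (-Real.log r) := h1
    _ ≤ _ := by gcongr; exact le_abs_self C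

lemma continuous_norm_circle {g : ℂ → ℂ} (hg : DifferentiableOn ℂ g (ball (0 : ℂ) 1)) {r : ℝ}
    (hr0 : 0 < r) (hr1 : r < 1) :
    Continuous fun θ : ℝ => ‖g (r * Complex.exp (θ * Complex.I))‖ := by
  refine (hg.continuousOn.comp_continuous (by fun_prop) fun θ => ?_).norm
  simpa [Complex.norm_exp_ofReal_mul_I, abs_of_pos hr0] using hr1

/-- The integral means of a Bloch function are `O((log (1 / (1 - r))) ^ (1 / 2))`. -/
lemma exists_mean_div_le_of_bloch {g : ℂ → ℂ} (hg : DifferentiableOn ℂ g (ball (0 : ℂ) 1))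
    {M : ℝ} (hM : ∀ z ∈ ball (0 : ℂ) 1, (1 - ‖z‖ ^ 2) * ‖deriv g z‖ ≤ M) :
    ∃ B : ℝ, ∀ᶠ r : ℝ in 𝓝[<] 1,
      ((2 * Real.pi)⁻¹ * ∫ θ in (0 : ℝ)..(2 * Real.pi),
          ‖g ((r : ℂ) * Complex.exp (θ * Complex.I))‖)
        / (Real.log (1 / (1 - r))) ^ ((1 : ℝ) / 2) ≤ B := by
  obtain ⟨C, K, hC, hK, h⟩ := exists_sq_integral_le_of_bloch hg hM
  refine ⟨(2 * Real.pi)⁻¹ * ((C + K) / 2 + Real.pi), ?_⟩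
  have hlt : max (Real.exp (-1)) (1 - Real.exp (-1)) < 1 :=
    max_lt (Real.exp_lt_one_iff.2 (by norm_num)) (by linarith [Real.exp_pos (-1)])
  filter_upwards [Ioo_mem_nhdsLT hlt] with r hr
  have hr1 : r < 1 := hr.2
  have hre : Real.exp (-1) ≤ r := (le_max_left _ _).trans hr.1.le
  have hre' : 1 - Real.exp (-1) ≤ r := (le_max_right _ _).trans hr.1.le
  have hr0 : 0 < r := (Real.exp_pos _).trans_le hre
  have h := h r hre hr1
  have hL : 1 ≤ Real.log (1 / (1 - r)) := by
    rw [one_div, Real.log_inv, le_neg, Real.log_le_iff_le_exp (by linarith)]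
    linarith
  rw [← Real.sqrt_eq_rpow]
  set L := Real.log (1 / (1 - r))
  set s := Real.sqrt L with hs
  have hs0 : 0 < s := Real.sqrt_pos.2 (by linarith)
  have hss : s * s = L := Real.mul_self_sqrt (by linarith)
  have hcont := continuous_norm_circle hg hr0 hr1
  have hint : (∫ θ in (0 : ℝ)..(2 * Real.pi), ‖g (r * Complex.exp (θ * Complex.I))‖)
      ≤ ∫ θ in (0 : ℝ)..(2 * Real.pi),
        ((2 * s)⁻¹ * ‖g (r * Complex.exp (θ * Complex.I))‖ ^ 2 + s / 2) := by
    refine intervalIntegral.integral_mono_on Real.two_pi_pos.le (hcont.intervalIntegrable _ _)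
      (((hcont.pow 2).const_mul _ |>.add continuous_const).intervalIntegrable _ _) fun θ _ => ?_
    set x := ‖g (r * Complex.exp (θ * Complex.I))‖
    have : (2 * s)⁻¹ * x ^ 2 + s / 2 - x = (2 * s)⁻¹ * (x - s) ^ 2 := by
      field_simp
      ring
    have : 0 ≤ (2 * s)⁻¹ * (x - s) ^ 2 := by positivity
    linarith
  have hcont2 : Continuous fun θ : ℝ =>
      (2 * s)⁻¹ * ‖g (r * Complex.exp (θ * Complex.I))‖ ^ 2 := by fun_prop
  rw [intervalIntegral.integral_add (hcont2.intervalIntegrable _ _)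
    intervalIntegrable_const, intervalIntegral.integral_const_mul, intervalIntegral.integral_const,
    sub_zero, smul_eq_mul] at hint
  rw [div_le_iff₀ hs0, mul_assoc]
  gcongr
  have h5 : C + K * L ≤ (C + K) * (s * s) := by
    rw [hss]; nlinarith
  calc _ ≤ _ := hint
    _ ≤ (2 * s)⁻¹ * ((C + K) * (s * s)) + 2 * Real.pi * (s / 2) := by gcongr; exact h.trans h5
    _ = _ := by field_simp



/-- If `|g₁(w)| + |g₂(w)| ≥ (1/12) log(e/(1-|w|))` near the boundary, then for at least
one `j`, the integral means of `g_j` divided by `(log(1/(1-r)))^{1/2}` have limsup `∞`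
as `r → 1⁻`, and in particular `g_j` is not a Bloch function. -/
theorem not_bloch_of_lower_bound (g₁ g₂ : ℂ → ℂ)
    (hg₁ : DifferentiableOn ℂ g₁ (ball (0 : ℂ) 1))
    (hg₂ : DifferentiableOn ℂ g₂ (ball (0 : ℂ) 1))
    (hlow : ∀ w : ℂ, 1 - Real.exp (-3) < ‖w‖ → ‖w‖ < 1 →
      (1 / 12) * Real.log (Real.exp 1 / (1 - ‖w‖)) ≤ ‖g₁ w‖ + ‖g₂ w‖) :
    ∃ g ∈ ({g₁, g₂} : Set (ℂ → ℂ)),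
      (∀ M : ℝ, ∃ᶠ r : ℝ in nhdsWithin (1 : ℝ) (Set.Iio (1 : ℝ)),
        M < ((2 * Real.pi)⁻¹ * ∫ θ in (0 : ℝ)..(2 * Real.pi),
              ‖g ((r : ℂ) * Complex.exp (θ * Complex.I))‖)
            / (Real.log (1 / (1 - r))) ^ ((1 : ℝ) / 2)) ∧
      ¬ ∃ M : ℝ, ∀ z ∈ ball (0 : ℂ) 1, (1 - ‖z‖ ^ 2) * ‖deriv g z‖ ≤ M := by

  have unbounded : ∃ g ∈ ({g₁, g₂} : Set (ℂ → ℂ)),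
      ∀ M : ℝ, ∃ᶠ r : ℝ in nhdsWithin (1 : ℝ) (Set.Iio (1 : ℝ)),
        M < ((2 * Real.pi)⁻¹ * ∫ θ in (0 : ℝ)..(2 * Real.pi),
              ‖g ((r : ℂ) * Complex.exp (θ * Complex.I))‖)
            / (Real.log (1 / (1 - r))) ^ ((1 : ℝ) / 2) := by
    by_contra! hcon
    obtain ⟨M₁, h₁⟩ := hcon g₁ (by simp)
    obtain ⟨M₂, h₂⟩ := hcon g₂ (by simp)
    have hlim : Tendsto (fun r : ℝ => Real.sqrt (Real.log (1 / (1 - r)))) (𝓝[<] 1) atTop := by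
      refine Real.tendsto_sqrt_atTop.comp (Real.tendsto_log_atTop.comp ?_)
      simp only [one_div]
      refine tendsto_inv_nhdsGT_zero.comp (tendsto_nhdsWithin_iff.2 ⟨?_, ?_⟩)
      · have : Tendsto (fun r : ℝ => 1 - r) (𝓝 1) (𝓝 (1 - 1)) := by
          exact (continuous_const.sub continuous_id).tendsto 1
        rw [sub_self] at this
        exact this.mono_left nhdsWithin_le_nhds
      · filter_upwards [self_mem_nhdsWithin] with r hr
        exact sub_pos.2 (Set.mem_Iio.1 hr)
    have hlt : 1 - Real.exp (-3) < 1 := by linarith [Real.exp_pos (-3)]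
    have hpos : (0 : ℝ) ≤ 1 - Real.exp (-3) := by
      linarith [Real.exp_le_one_iff.2 (show (-3 : ℝ) ≤ 0 by norm_num)]
    obtain ⟨r, h₁, h₂, hbig, hr⟩ := (h₁.and (h₂.and ((hlim.eventually_gt_atTop
      (max 0 (12 * (M₁ + M₂)))).and (Ioo_mem_nhdsLT hlt)))).exists
    have hr1 : r < 1 := hr.2
    have hr0 : 0 < r := hpos.trans_lt hr.1
    rw [← Real.sqrt_eq_rpow] at h₁ h₂
    set L := Real.log (1 / (1 - r)) with hL
    have hs0 : 0 < Real.sqrt L := (le_max_left _ _).trans_lt hbig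
    have hbig' : 12 * (M₁ + M₂) < Real.sqrt L := (le_max_right _ _).trans_lt hbig
    have hss : Real.sqrt L * Real.sqrt L = L := Real.mul_self_sqrt (Real.sqrt_pos.1 hs0).le
    have c₁ := continuous_norm_circle hg₁ hr0 hr1
    have c₂ := continuous_norm_circle hg₂ hr0 hr1
    have hint : (∫ _ in (0 : ℝ)..(2 * Real.pi), L / 12)
        ≤ ∫ θ in (0 : ℝ)..(2 * Real.pi), (‖g₁ (r * Complex.exp (θ * Complex.I))‖
          + ‖g₂ (r * Complex.exp (θ * Complex.I))‖) := by
      refine intervalIntegral.integral_mono_on Real.two_pi_pos.le intervalIntegrable_const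
        ((c₁.add c₂).intervalIntegrable _ _) fun θ _ => ?_
      have hn : ‖(r : ℂ) * Complex.exp (θ * Complex.I)‖ = r := by
        simp [Complex.norm_exp_ofReal_mul_I, abs_of_pos hr0]
      have h := hlow (r * Complex.exp (θ * Complex.I)) (by rw [hn]; exact hr.1)
        (by rw [hn]; exact hr1)
      rw [hn] at h
      have h1r : 0 < 1 - r := by linarith
      have hle : L ≤ Real.log (Real.exp 1 / (1 - r)) :=
        Real.log_le_log (by positivity) (by gcongr; exact Real.one_le_exp zero_le_one)
      linarith
    rw [intervalIntegral.integral_const, sub_zero, smul_eq_mul, intervalIntegral.integral_add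
      (c₁.intervalIntegrable _ _) (c₂.intervalIntegrable _ _)] at hint
    rw [div_le_iff₀ hs0, inv_mul_le_iff₀ Real.two_pi_pos] at h₁ h₂
    have hfin : 2 * Real.pi * (L / 12) ≤ 2 * Real.pi * ((M₁ + M₂) * Real.sqrt L) := by linarith
    have hfin' := le_of_mul_le_mul_left hfin Real.two_pi_pos
    nlinarith
  obtain ⟨g, hmem, hfreq⟩ := unbounded
  refine ⟨g, hmem, hfreq, fun ⟨M, hM⟩ => ?_⟩
  have hg : DifferentiableOn ℂ g (ball (0 : ℂ) 1) := by
    rcases hmem with rfl | rfl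
    · exact hg₁
    · exact hg₂
  obtain ⟨B, hB⟩ := exists_mean_div_le_of_bloch hg hM
  exact hfreq B (hB.mono fun r hr => not_lt.2 hr)
end

section
/- Assuming there exist analytic functions f1, f2 on the unit disk with sup_{z∈D}|f_i(z)|/log(e/(1-|z|)) < ∞ for i = 1,2 and |f1(z)| + |f2(z)| ≥ log(1/(1-|z|)) for all z ∈ D, the Bloch space is not dense in X: there exists f ∈ X such that for every Bloch function g, sup_{z∈D} |f(z) - g(z)|/log(e/(1-|z|)) ≥ 1/3. -/
open Metric

theorem norm_fourier_one_apply (x : AddCircle (1 : ℝ)) : ‖fourier 1 x‖ = 1 := by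
  rw [fourier_one]
  exact Circle.norm_coe _

theorem norm_ofReal_mul_fourier_one {r : ℝ} (hr : 0 ≤ r) (x : AddCircle (1 : ℝ)) :
    ‖(r * fourier 1 x : ℂ)‖ = r := by
  rw [norm_mul, norm_fourier_one_apply, mul_one, Complex.norm_of_nonneg hr]

open MeasureTheory in
theorem hasSum_norm_sq_integral_circle {c : ℕ → ℂ} (hc : Summable c) {F : C(AddCircle (1 : ℝ), ℂ)}
    (hF : ∀ x, HasSum (fun n => c n * fourier 1 x ^ n) (F x)) :
    HasSum (fun n => ‖c n‖ ^ 2) (∫ x, ‖F x‖ ^ 2 ∂AddCircle.haarAddCircle) := by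
  have hpow (n : ℕ) (x : AddCircle (1 : ℝ)) : fourier (n : ℤ) x = fourier 1 x ^ n := by
    simp [fourier_apply, AddCircle.toCircle_nsmul]
  have hsum : HasSum (fun n : ℕ => c n • (fourier (n : ℤ) : C(AddCircle (1 : ℝ), ℂ))) F := by
    have hs : Summable (fun n : ℕ => c n • (fourier (n : ℤ) : C(AddCircle (1 : ℝ), ℂ))) := by
      refine .of_norm ?_
      simpa [norm_smul, fourier_norm] using hc.norm
    convert hs.hasSum
    ext x
    refine (hF x).unique ?_
    simpa [hpow] using ContinuousMap.hasSum_apply hs.hasSum x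
  set E := ContinuousMap.toLp (E := ℂ) 2 (AddCircle.haarAddCircle (T := (1 : ℝ))) ℂ
  have hL : HasSum (fun n : ℕ => c n • fourierLp (T := (1 : ℝ)) 2 (n : ℤ)) (E F) := by
    simpa [E, fourierLp, Function.comp_def] using E.hasSum hsum
  have hcoef (n : ℕ) : inner ℂ (fourierLp (T := (1 : ℝ)) 2 (n : ℤ)) (E F) = c n := by
    have h := (innerSL ℂ (fourierLp (T := (1 : ℝ)) 2 (n : ℤ))).hasSum hL
    refine h.unique ?_
    have ho := orthonormal_iff_ite.mp (orthonormal_fourier (T := (1 : ℝ)))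
    refine (hasSum_ite_eq n (c n)).congr_fun fun m => ?_
    by_cases h : n = m
    · rw [innerSL_apply_apply, inner_smul_right, ho]
      simp [h]
    · rw [innerSL_apply_apply, inner_smul_right, ho]
      simp [h, Ne.symm h]
  have h := (innerSL ℂ (E F)).hasSum hL
  have h2 : HasSum (fun n => ((‖c n‖ ^ 2 : ℝ) : ℂ)) (inner ℂ (E F) (E F)) := by
    refine h.congr_fun fun n => ?_
    rw [innerSL_apply_apply, inner_smul_right, ← inner_conj_symm, hcoef, Complex.mul_conj, Complex.normSq_eq_norm_sq]
  rw [ContinuousMap.inner_toLp] at h2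
  have h3 : (∫ x, F x * (starRingEnd ℂ) (F x) ∂AddCircle.haarAddCircle)
      = ((∫ x, ‖F x‖ ^ 2 ∂AddCircle.haarAddCircle : ℝ) : ℂ) := by
    rw [← integral_complex_ofReal]
    congr with x
    rw [Complex.mul_conj, Complex.normSq_eq_norm_sq]
  rw [h3] at h2
  exact_mod_cast h2

theorem sum_le_log_of_sum_sq_le {A : ℕ → ℝ} {K : ℝ} {N : ℕ}
    (h : ∀ x ∈ Set.Ico (0 : ℝ) 1,
      ∑ n ∈ Finset.range N, ((n : ℝ) + 1) ^ 2 * A n * x ^ n ≤ K / (1 - x) ^ 2)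
    {x : ℝ} (hx : x ∈ Set.Ico (0 : ℝ) 1) :
    ∑ n ∈ Finset.range N, A n * x ^ (n + 1) ≤ K * Real.log (1 / (1 - x)) := by
  have hK (x : ℝ) (hx : x ∈ Set.Ico (0 : ℝ) 1) :
      ∑ n ∈ Finset.range N, ((n : ℝ) + 1) * A n * x ^ (n + 1) ≤ K * (1 / (1 - x) - 1) := by
    have hd (y : ℝ) (hy : y ∈ Set.Ico (0 : ℝ) 1) :
        HasDerivAt (fun x : ℝ => K * (1 / (1 - x) - 1)
          - ∑ n ∈ Finset.range N, ((n : ℝ) + 1) * A n * x ^ (n + 1))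
          (K / (1 - y) ^ 2 - ∑ n ∈ Finset.range N, ((n : ℝ) + 1) ^ 2 * A n * y ^ n) y := by
      have hy' : 1 - y ≠ 0 := by linarith [hy.2]
      refine .sub ?_ (.fun_sum fun n _ => ?_)
      · simp_rw [one_div]
        refine (((((hasDerivAt_id' y).const_sub 1).fun_inv hy').sub_const 1).const_mul
          K).congr_deriv ?_
        rw [neg_neg, mul_one_div]
      · refine ((hasDerivAt_pow (n + 1) y).const_mul (((n : ℝ) + 1) * A n)).congr_deriv ?_
        push_cast [Nat.add_sub_cancel]
        ring
    have hm := monotoneOn_of_deriv_nonneg (convex_Ico (0 : ℝ) 1)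
      (fun y hy => (hd y hy).continuousAt.continuousWithinAt)
      (fun y hy => (hd y (interior_subset hy)).differentiableAt.differentiableWithinAt)
      (fun y hy => by
        rw [(hd y (interior_subset hy)).deriv]
        exact sub_nonneg.mpr (h y (interior_subset hy)))
    simpa using hm ⟨le_rfl, one_pos⟩ hx hx.1
  have hd (y : ℝ) (hy : y ∈ Set.Ico (0 : ℝ) 1) :
      HasDerivAt (fun x : ℝ => K * Real.log (1 / (1 - x))
        - ∑ n ∈ Finset.range N, A n * x ^ (n + 1))
        (K / (1 - y) - ∑ n ∈ Finset.range N, ((n : ℝ) + 1) * A n * y ^ n) y := by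
    have hy' : 1 - y ≠ 0 := by linarith [hy.2]
    refine .sub ?_ (.fun_sum fun n _ => ?_)
    · simp_rw [one_div, Real.log_inv]
      refine ((((hasDerivAt_id' y).const_sub 1).log hy').fun_neg.const_mul K).congr_deriv ?_
      rw [neg_div, neg_neg, mul_one_div]
    · refine ((hasDerivAt_pow (n + 1) y).const_mul (A n)).congr_deriv ?_
      push_cast [Nat.add_sub_cancel]
      ring
  have hm := monotoneOn_of_deriv_nonneg (convex_Ico (0 : ℝ) 1)
    (fun y hy => (hd y hy).continuousAt.continuousWithinAt)
    (fun y hy => (hd y (interior_subset hy)).differentiableAt.differentiableWithinAt)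
    (fun y hy => by
      rw [(hd y (interior_subset hy)).deriv, sub_nonneg]
      have hy1 := hK y (interior_subset hy)
      rw [interior_Ico] at hy
      have hy' : 0 < 1 - y := by linarith [hy.2]
      refine le_of_mul_le_mul_left ?_ hy.1
      calc y * ∑ n ∈ Finset.range N, ((n : ℝ) + 1) * A n * y ^ n
          = ∑ n ∈ Finset.range N, ((n : ℝ) + 1) * A n * y ^ (n + 1) := by
            rw [Finset.mul_sum]; exact Finset.sum_congr rfl fun _ _ => by ring
        _ ≤ _ := hy1
        _ = _ := by field_simp; ring)
  simpa using hm ⟨le_rfl, one_pos⟩ hx hx.1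

/-- The map `x ↦ g (r e^{2πix})`. -/
noncomputable def circleRestrict (g : ℂ → ℂ) (hg : ContinuousOn g (ball 0 1)) (r : ℝ)
    (hr : r ∈ Set.Ico (0 : ℝ) 1) : C(AddCircle (1 : ℝ), ℂ) where
  toFun x := g (r * fourier 1 x)
  continuous_toFun := by
    refine hg.comp_continuous (by fun_prop) fun x => ?_
    rw [mem_ball_zero_iff, norm_ofReal_mul_fourier_one hr.1]
    exact hr.2

open MeasureTheory in
theorem hasSum_taylor_norm_sq {g : ℂ → ℂ} (hg : DifferentiableOn ℂ g (ball 0 1)) {r : ℝ}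
    (hr : r ∈ Set.Ico (0 : ℝ) 1) :
    HasSum (fun n : ℕ => ‖(n.factorial : ℂ)⁻¹ * iteratedDeriv n g 0‖ ^ 2 * (r ^ 2) ^ n)
      (∫ x : AddCircle (1 : ℝ), ‖g (r * fourier 1 x)‖ ^ 2 ∂AddCircle.haarAddCircle) := by
  have hmem (w : ℂ) (hw : ‖w‖ = 1) : (r * w : ℂ) ∈ ball (0 : ℂ) 1 := by
    simpa [hw, abs_of_nonneg hr.1] using hr.2
  have hT (w : ℂ) (hw : ‖w‖ = 1) :
      HasSum (fun n : ℕ => ((n.factorial : ℂ)⁻¹ * iteratedDeriv n g 0 * r ^ n) * w ^ n)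
        (g (r * w)) := by
    refine (Complex.hasSum_taylorSeries_on_ball hg (hmem w hw)).congr_fun fun n => ?_
    simp only [sub_zero, smul_eq_mul, mul_pow]
    ring
  have h := hasSum_norm_sq_integral_circle
    (F := circleRestrict g hg.continuousOn r hr) (by simpa using (hT 1 (by simp)).summable)
    (fun x => hT (fourier 1 x) (norm_fourier_one_apply x))
  refine HasSum.congr_fun h fun n => ?_
  simp only [norm_mul, norm_pow, Complex.norm_real, Real.norm_of_nonneg hr.1]
  ring

open MeasureTheory in
theorem bloch_integral_norm_sq_le {g : ℂ → ℂ} (hg : DifferentiableOn ℂ g (ball 0 1)) {M : ℝ}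
    (hM : ∀ z ∈ ball (0 : ℂ) 1, (1 - ‖z‖ ^ 2) * ‖deriv g z‖ ≤ M) {r : ℝ}
    (hr : r ∈ Set.Ico (0 : ℝ) 1) :
    ∫ x : AddCircle (1 : ℝ), ‖g (r * fourier 1 x)‖ ^ 2 ∂AddCircle.haarAddCircle
      ≤ ‖g 0‖ ^ 2 + M ^ 2 * Real.log (1 / (1 - r)) := by
  have hg' : DifferentiableOn ℂ (deriv g) (ball 0 1) := hg.deriv isOpen_ball
  set a : ℕ → ℂ := fun n => (n.factorial : ℂ)⁻¹ * iteratedDeriv n g 0 with ha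
  have hsq (x : ℝ) (hx : x ∈ Set.Ico (0 : ℝ) 1) (N : ℕ) :
      ∑ n ∈ Finset.range N, ((n : ℝ) + 1) ^ 2 * ‖a (n + 1)‖ ^ 2 * x ^ n
        ≤ M ^ 2 / (1 - x) ^ 2 := by
    have hs : √x ∈ Set.Ico (0 : ℝ) 1 :=
      ⟨Real.sqrt_nonneg x, by rw [Real.sqrt_lt' one_pos]; simpa using hx.2⟩
    have h := hasSum_taylor_norm_sq hg' hs
    rw [Real.sq_sqrt hx.1] at h
    have hterm (n : ℕ) : ((n : ℝ) + 1) ^ 2 * ‖a (n + 1)‖ ^ 2 * x ^ n =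
        ‖(n.factorial : ℂ)⁻¹ * iteratedDeriv n (deriv g) 0‖ ^ 2 * x ^ n := by
      have h1 : (n.factorial : ℂ)⁻¹ * iteratedDeriv n (deriv g) 0
          = ((n : ℂ) + 1) * a (n + 1) := by
        have : (n : ℂ) + 1 ≠ 0 := by exact_mod_cast n.succ_ne_zero
        simp only [ha, iteratedDeriv_succ', Nat.factorial_succ]
        push_cast
        field_simp
      have h2 : ‖(n : ℂ) + 1‖ = (n : ℝ) + 1 := by exact_mod_cast Complex.norm_natCast (n + 1)
      rw [h1, norm_mul ((n : ℂ) + 1), h2]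
      ring
    simp_rw [hterm]
    refine (sum_le_hasSum _ (fun n _ => mul_nonneg (by positivity) (pow_nonneg hx.1 n)) h).trans ?_
    have hpt (y : AddCircle (1 : ℝ)) :
        ‖deriv g (√x * fourier 1 y)‖ ^ 2 ≤ M ^ 2 / (1 - x) ^ 2 := by
      have hn : ‖(√x * fourier 1 y : ℂ)‖ = √x :=
        norm_ofReal_mul_fourier_one hs.1 y
      have hz := hM (√x * fourier 1 y) (by rw [mem_ball_zero_iff, hn]; exact hs.2)
      rw [hn, Real.sq_sqrt hx.1] at hz
      have hx' : 0 < 1 - x := by linarith [hx.2]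
      rw [← div_pow]
      gcongr
      rw [le_div_iff₀ hx', mul_comm]
      exact hz
    refine (integral_mono_of_nonneg (.of_forall fun _ => by positivity) (integrable_const _)
      (.of_forall hpt)).trans ?_
    simp
  have hsum := hasSum_taylor_norm_sq hg hr
  have hr2 : r ^ 2 ∈ Set.Ico (0 : ℝ) 1 := ⟨sq_nonneg r, by nlinarith [hr.1, hr.2]⟩
  refine le_of_tendsto' ((Filter.tendsto_add_atTop_iff_nat 1).mpr hsum.tendsto_sum_nat)
    fun N => ?_
  rw [Finset.sum_range_succ', add_comm]
  have h0 : ‖((0 : ℕ).factorial : ℂ)⁻¹ * iteratedDeriv 0 g 0‖ ^ 2 * (r ^ 2) ^ 0 = ‖g 0‖ ^ 2 := by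
    simp
  rw [h0]
  gcongr
  refine (sum_le_log_of_sum_sq_le (fun x hx => hsq x hx N) hr2).trans ?_
  have h1 : 0 < 1 - r := by linarith [hr.2]
  refine mul_le_mul_of_nonneg_left (Real.log_le_log ?_ ?_) (sq_nonneg M)
  · exact one_div_pos.mpr (by linarith [hr2.2])
  · exact one_div_le_one_div_of_le h1 (by nlinarith [hr.1, hr.2])

open MeasureTheory in
theorem exists_small_of_bloch {g₁ g₂ : ℂ → ℂ} (hg₁ : DifferentiableOn ℂ g₁ (ball 0 1))
    (hg₂ : DifferentiableOn ℂ g₂ (ball 0 1)) {M₁ M₂ : ℝ}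
    (hM₁ : ∀ z ∈ ball (0 : ℂ) 1, (1 - ‖z‖ ^ 2) * ‖deriv g₁ z‖ ≤ M₁)
    (hM₂ : ∀ z ∈ ball (0 : ℂ) 1, (1 - ‖z‖ ^ 2) * ‖deriv g₂ z‖ ≤ M₂) :
    ∃ z ∈ ball (0 : ℂ) 1, ‖g₁ z‖ + ‖g₂ z‖ < (Real.log (1 / (1 - ‖z‖)) - 2) / 3 := by
  by_contra! hcon
  set A := ‖g₁ 0‖ ^ 2 + ‖g₂ 0‖ ^ 2
  set B := M₁ ^ 2 + M₂ ^ 2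
  have hA : 0 ≤ A := by positivity
  have hB : 0 ≤ B := by positivity
  set t := 18 * (A + 2 * B) + 18 * B + 1 with ht
  have ht0 : 1 ≤ t := by rw [ht]; linarith
  set r := 1 - Real.exp (-(2 + t)) with hrdef
  have hr : r ∈ Set.Ico (0 : ℝ) 1 :=
    ⟨sub_nonneg.mpr (Real.exp_le_one_iff.mpr (by linarith)),
      sub_lt_self _ (Real.exp_pos _)⟩
  have hlog : Real.log (1 / (1 - r)) = 2 + t := by simp [hrdef]
  have hn : ∀ x : AddCircle (1 : ℝ), ‖(r * fourier 1 x : ℂ)‖ = r :=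
    norm_ofReal_mul_fourier_one hr.1
  have hpt (x : AddCircle (1 : ℝ)) :
      t ^ 2 / 18 ≤ ‖g₁ (r * fourier 1 x)‖ ^ 2 + ‖g₂ (r * fourier 1 x)‖ ^ 2 := by
    have h := hcon (r * fourier 1 x) (by rw [mem_ball_zero_iff, hn]; exact hr.2)
    rw [hn, hlog] at h
    nlinarith [sq_nonneg (‖g₁ (r * fourier 1 x)‖ - ‖g₂ (r * fourier 1 x)‖)]
  have hint {g : ℂ → ℂ} (hg : DifferentiableOn ℂ g (ball 0 1)) :
      Integrable (fun x : AddCircle (1 : ℝ) => ‖g (r * fourier 1 x)‖ ^ 2)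
        AddCircle.haarAddCircle :=
    ((circleRestrict g hg.continuousOn r hr).continuous.norm.pow 2).integrable_of_hasCompactSupport
      (.of_compactSpace _)
  have h := integral_mono (μ := AddCircle.haarAddCircle) (integrable_const _)
    ((hint hg₁).add (hint hg₂)) hpt
  rw [integral_const, probReal_univ, one_smul, integral_add' (hint hg₁) (hint hg₂)] at h
  have h₁ := bloch_integral_norm_sq_le hg₁ hM₁ hr
  have h₂ := bloch_integral_norm_sq_le hg₂ hM₂ hr
  rw [hlog] at h₁ h₂
  have h3 : t ^ 2 / 18 ≤ A + B * (2 + t) := by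
    simp only [A, B]
    linarith
  nlinarith

/-- Assuming the existence of `f₁, f₂ ∈ X = H^∞_log` with
`|f₁(z)| + |f₂(z)| ≥ log(1/(1-|z|))` on the disk, the Bloch space is not dense in `X`:
there is `f ∈ X` whose distance in the `X`-norm to every Bloch function is `≥ 1/3`. -/
theorem bloch_not_dense_in_X
    (hex : ∃ f₁ f₂ : ℂ → ℂ,
      DifferentiableOn ℂ f₁ (ball (0 : ℂ) 1) ∧ DifferentiableOn ℂ f₂ (ball (0 : ℂ) 1) ∧
      (∃ M₁ : ℝ, ∀ z ∈ ball (0 : ℂ) 1,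
        ‖f₁ z‖ / Real.log (Real.exp 1 / (1 - ‖z‖)) ≤ M₁) ∧
      (∃ M₂ : ℝ, ∀ z ∈ ball (0 : ℂ) 1,
        ‖f₂ z‖ / Real.log (Real.exp 1 / (1 - ‖z‖)) ≤ M₂) ∧
      (∀ z ∈ ball (0 : ℂ) 1, Real.log (1 / (1 - ‖z‖)) ≤ ‖f₁ z‖ + ‖f₂ z‖)) :
    ∃ f : ℂ → ℂ, DifferentiableOn ℂ f (ball (0 : ℂ) 1) ∧
      (∃ M : ℝ, ∀ z ∈ ball (0 : ℂ) 1,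
        ‖f z‖ / Real.log (Real.exp 1 / (1 - ‖z‖)) ≤ M) ∧
      ∀ g : ℂ → ℂ, DifferentiableOn ℂ g (ball (0 : ℂ) 1) →
        (∃ M : ℝ, ∀ z ∈ ball (0 : ℂ) 1, (1 - ‖z‖ ^ 2) * ‖deriv g z‖ ≤ M) →
        ∀ ε : ℝ, 0 < ε → ∃ z ∈ ball (0 : ℂ) 1,
          1 / 3 - ε < ‖f z - g z‖ / Real.log (Real.exp 1 / (1 - ‖z‖)) := by
  obtain ⟨f₁, f₂, hf₁, hf₂, hb₁, hb₂, hlow⟩ := hex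
  by_contra! hcon
  obtain ⟨g₁, hg₁, ⟨M₁, hM₁⟩, ε₁, hε₁, h₁⟩ := hcon f₁ hf₁ hb₁
  obtain ⟨g₂, hg₂, ⟨M₂, hM₂⟩, ε₂, hε₂, h₂⟩ := hcon f₂ hf₂ hb₂
  obtain ⟨z, hz, hsmall⟩ := exists_small_of_bloch hg₁ hg₂ hM₁ hM₂
  have hz' : 0 < 1 - ‖z‖ := by simpa using hz
  have hlog : Real.log (Real.exp 1 / (1 - ‖z‖)) = 1 + Real.log (1 / (1 - ‖z‖)) := by
    rw [div_eq_mul_one_div, Real.log_mul (Real.exp_ne_zero 1) (by positivity), Real.log_exp]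
  have hpos : 0 ≤ Real.log (1 / (1 - ‖z‖)) :=
    Real.log_nonneg (by rw [le_div_iff₀ hz']; linarith [norm_nonneg z])
  have k₁ := h₁ z hz
  have k₂ := h₂ z hz
  rw [hlog, div_le_iff₀ (by linarith)] at k₁ k₂
  nlinarith [hlow z hz, norm_sub_norm_le (f₁ z) (g₁ z), norm_sub_norm_le (f₂ z) (g₂ z)]
end
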